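/- Let 𝔤 be a finite-dimensional complex simple Lie algebra, 𝔥 ⊆ 𝔤 a Cartan subalgebra, Φ⁺ a set of positive roots of Φ(𝔤,𝔥), and σ : 𝔤 → 𝔤 a conjugate-linear involution with σ(𝔥) = 𝔥 and σ*(Φ⁺) = −Φ⁺. For each α ∈ Φ⁺ choose x_α ∈ 𝔤_α and x_{−α} ∈ 𝔤_{−α} with κ(x_α, x_{−α}) = 1, and set S = Σ_{α∈Φ⁺} (x_{−α} ⊗ x_α − x_α ⊗ x_{−α}) ∈ 𝔤 ⊗ 𝔤. Then (σ ⊗ σ)(S) = −S, where σ ⊗ σ is the real-linear map on 𝔤 ⊗ 𝔤 with (σ ⊗ σ)(u ⊗ v) = σ(u) ⊗ σ(v). -/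

import Mathlib

open scoped TensorProduct BigOperators

/-- A conjugate-linear involutive Lie algebra automorphism of a complex Lie algebra. -/
def IsConjLinearInvolution {L : Type*} [LieRing L] [LieAlgebra ℂ L] (σ : L → L) : Prop :=
  (∀ x y : L, σ (x + y) = σ x + σ y) ∧
  (∀ (z : ℂ) (x : L), σ (z • x) = (starRingEnd ℂ) z • σ x) ∧
  (∀ x y : L, σ ⁅x, y⁆ = ⁅σ x, σ y⁆) ∧
  (∀ x : L, σ (σ x) = x)

/-- `x` is a root vector for the functional `α` on the Cartan subalgebra `H`. -/
def IsRootVector {L : Type*} [LieRing L] [LieAlgebra ℂ L] (H : LieSubalgebra ℂ L)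
    (α : H → ℂ) (x : L) : Prop :=
  ∀ h : H, ⁅(h : L), x⁆ = α h • x

/-- `α` is a root of `(L, H)`: a nonzero functional admitting a nonzero root vector. -/
def IsRoot {L : Type*} [LieRing L] [LieAlgebra ℂ L] (H : LieSubalgebra ℂ L)
    (α : H → ℂ) : Prop :=
  α ≠ 0 ∧ ∃ x : L, x ≠ 0 ∧ IsRootVector H α x

/-- `P` is a system of positive roots: a set of roots containing exactly one of `β`, `-β`
for each root `β`, and closed under addition of roots. -/
def IsPositiveSystem {L : Type*} [LieRing L] [LieAlgebra ℂ L] (H : LieSubalgebra ℂ L)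
    (P : Finset (H → ℂ)) : Prop :=
  (∀ α ∈ P, IsRoot H α) ∧
  (∀ β : H → ℂ, IsRoot H β → (β ∈ P ∨ -β ∈ P)) ∧
  (∀ β ∈ P, -β ∉ P) ∧
  (∀ α ∈ P, ∀ β ∈ P, IsRoot H (α + β) → α + β ∈ P)

/-- The functional `σ*(α)`, given by `σ*(α)(h) = conj (α (σ h))`. -/
def sigmaStar {L : Type*} [LieRing L] [LieAlgebra ℂ L] (H : LieSubalgebra ℂ L)
    (σ : L → L) (hH : ∀ x ∈ H, σ x ∈ H) (α : H → ℂ) : H → ℂ :=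
  fun h => (starRingEnd ℂ) (α ⟨σ (h : L), hH (h : L) h.2⟩)

/-- The trace of an endomorphism conjugated by a conjugate-linear involution is the complex
conjugate of the original trace. -/
theorem trace_eq_conj_of_conjLinear_involution {V : Type*} [AddCommGroup V] [Module ℂ V]
    [FiniteDimensional ℂ V] {σ : V → V} (hadd : ∀ x y : V, σ (x + y) = σ x + σ y)
    (hsmul : ∀ (z : ℂ) (x : V), σ (z • x) = (starRingEnd ℂ) z • σ x)
    (hinv : ∀ x : V, σ (σ x) = x) {f g : V →ₗ[ℂ] V} (hfg : ∀ v, g (σ v) = σ (f v)) :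
    LinearMap.trace ℂ V g = (starRingEnd ℂ) (LinearMap.trace ℂ V f) := by
  let b := Module.finBasis ℂ V
  let e : V ≃ₗ[ℂ] (Fin (Module.finrank ℂ V) → ℂ) :=
    { toFun := fun v i => (starRingEnd ℂ) (b.equivFun (σ v) i)
      map_add' := fun v w => by ext i; simp [hadd]
      map_smul' := fun z v => by ext i; simp [hsmul]
      invFun := fun c => σ (b.equivFun.symm fun i => (starRingEnd ℂ) (c i))
      left_inv := fun v => by
        simp only [Complex.conj_conj]
        rw [LinearEquiv.symm_apply_apply, hinv]
      right_inv := fun c => by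
        ext i
        dsimp only
        rw [hinv, LinearEquiv.apply_symm_apply, Complex.conj_conj] }
  let b' := Module.Basis.ofEquivFun e
  have hb' : ∀ i, b' i = σ (b i) := fun i => by
    rw [Module.Basis.coe_ofEquivFun, LinearEquiv.symm_apply_eq]
    ext j
    simp [e, hinv, Finsupp.single_apply, Pi.single_apply, eq_comm, apply_ite (starRingEnd ℂ)]
  rw [LinearMap.trace_eq_matrix_trace ℂ b', LinearMap.trace_eq_matrix_trace ℂ b,
    Matrix.trace, Matrix.trace, map_sum]
  refine Finset.sum_congr rfl fun i _ => ?_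
  rw [Matrix.diag_apply, Matrix.diag_apply, LinearMap.toMatrix_apply, LinearMap.toMatrix_apply,
    hb', hfg]
  simp [b', e, hinv]

namespace IsConjLinearInvolution

variable {L : Type*} [LieRing L] [LieAlgebra ℂ L] {σ : L → L}

theorem killingForm_apply_apply [FiniteDimensional ℂ L] (hσ : IsConjLinearInvolution σ)
    (x y : L) :
    killingForm ℂ L (σ x) (σ y) = (starRingEnd ℂ) (killingForm ℂ L x y) := by
  obtain ⟨hadd, hsmul, hlie, hinv⟩ := hσ
  rw [_root_.killingForm_apply_apply, _root_.killingForm_apply_apply]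
  exact trace_eq_conj_of_conjLinear_involution hadd hsmul hinv fun v => by simp [hlie]

variable {H : LieSubalgebra ℂ L}

theorem isRootVector_sigmaStar (hσ : IsConjLinearInvolution σ) (hH : ∀ x ∈ H, σ x ∈ H)
    {α : H → ℂ} {x : L} (hx : IsRootVector H α x) :
    IsRootVector H (sigmaStar H σ hH α) (σ x) := by
  intro h
  obtain ⟨-, hsmul, hlie, hinv⟩ := hσ
  rw [sigmaStar, ← hsmul, ← hx, hlie, hinv]

theorem sigmaStar_sigmaStar (hσ : IsConjLinearInvolution σ) (hH : ∀ x ∈ H, σ x ∈ H)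
    (α : H → ℂ) : sigmaStar H σ hH (sigmaStar H σ hH α) = α := by
  ext h
  simp [sigmaStar, hσ.2.2.2]

end IsConjLinearInvolution

theorem sigmaStar_neg {L : Type*} [LieRing L] [LieAlgebra ℂ L] {H : LieSubalgebra ℂ L}
    (σ : L → L) (hH : ∀ x ∈ H, σ x ∈ H) (α : H → ℂ) :
    sigmaStar H σ hH (-α) = -sigmaStar H σ hH α := by
  ext h
  simp [sigmaStar]

/-- Root spaces of a complex Lie algebra with nondegenerate Killing form are lines. -/
theorem IsRootVector.exists_smul_eq {L : Type*} [LieRing L] [LieAlgebra ℂ L]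
    [FiniteDimensional ℂ L] [LieAlgebra.IsKilling ℂ L] {H : LieSubalgebra ℂ L}
    [H.IsCartanSubalgebra] {α : H → ℂ} (hα : α ≠ 0) {x y : L} (hx : IsRootVector H α x)
    (hy : IsRootVector H α y) (hx0 : x ≠ 0) : ∃ c : ℂ, c • x = y := by
  have mem {v : L} (hv : IsRootVector H α v) : v ∈ LieAlgebra.rootSpace H α :=
    LieModule.weightSpace_le_genWeightSpace L α ((LieModule.mem_weightSpace α v).mpr hv)
  let w : LieModule.Weight ℂ H L :=
    ⟨α, fun h => hx0 (by simpa [h] using mem hx)⟩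
  have hw : w.IsNonZero := fun h => hα h
  obtain ⟨c, hc⟩ := (finrank_eq_one_iff_of_nonzero' (⟨x, mem hx⟩ : LieAlgebra.rootSpace H α)
    (by simpa using hx0)).mp (LieAlgebra.IsKilling.finrank_rootSpace_eq_one w hw) ⟨y, mem hy⟩
  exact ⟨c, congrArg Subtype.val hc⟩

/-- if `σ*(Φ⁺) = -Φ⁺` then the element
`S = Σ_{α ∈ Φ⁺} (x_{-α} ⊗ x_α - x_α ⊗ x_{-α})` satisfies `(σ ⊗ σ)(S) = -S`. -/
theorem sigma_negates_skew_casimir_of_antistable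
    (L : Type*) [LieRing L] [LieAlgebra ℂ L] [FiniteDimensional ℂ L]
    [LieAlgebra.IsSimple ℂ L]
    (H : LieSubalgebra ℂ L) [H.IsCartanSubalgebra]
    (P : Finset (H → ℂ)) (hP : IsPositiveSystem H P)
    (σ : L → L) (hσ : IsConjLinearInvolution σ)
    (hH : ∀ x ∈ H, σ x ∈ H)
    (hantistable : (sigmaStar H σ hH) '' (P : Set (H → ℂ)) =
      (fun a : H → ℂ => -a) '' (P : Set (H → ℂ)))
    (x : (H → ℂ) → L)
    (hx : ∀ α ∈ P, IsRootVector H α (x α) ∧ IsRootVector H (-α) (x (-α)) ∧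
      killingForm ℂ L (x α) (x (-α)) = 1) :
    ∑ α ∈ P, (σ (x (-α)) ⊗ₜ[ℂ] σ (x α) - σ (x α) ⊗ₜ[ℂ] σ (x (-α))) =
      -∑ α ∈ P, (x (-α) ⊗ₜ[ℂ] x α - x α ⊗ₜ[ℂ] x (-α)) := by
  let τ : (H → ℂ) → (H → ℂ) := fun α => -sigmaStar H σ hH α
  have hτP : ∀ α ∈ P, τ α ∈ P := fun α hα => by
    obtain ⟨β, hβ, hαβ⟩ : sigmaStar H σ hH α ∈ (fun a : H → ℂ => -a) '' (P : Set (H → ℂ)) :=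
      hantistable ▸ Set.mem_image_of_mem _ hα
    simpa [τ, ← hαβ] using hβ
  have hττ : ∀ α, τ (τ α) = α := fun α => by
    simp [τ, sigmaStar_neg, hσ.sigmaStar_sigmaStar]
  rw [← Finset.sum_neg_distrib]
  refine Finset.sum_nbij' τ τ hτP hτP (fun α _ => hττ α) (fun α _ => hττ α) fun α hα => ?_
  obtain ⟨hpos, hneg, hκ⟩ := hx α hα
  obtain ⟨hpos', hneg', hκ'⟩ := hx (τ α) (hτP α hα)
  have hτ0 : τ α ≠ 0 := (hP.1 _ (hτP α hα)).1
  have hσneg : IsRootVector H (τ α) (σ (x (-α))) := by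
    simpa only [τ, sigmaStar_neg] using hσ.isRootVector_sigmaStar hH hneg
  have hσpos : IsRootVector H (-τ α) (σ (x α)) := by
    simpa only [τ, neg_neg] using hσ.isRootVector_sigmaStar hH hpos
  obtain ⟨a, ha⟩ := hpos'.exists_smul_eq hτ0 hσneg (fun h => by simp [h] at hκ')
  obtain ⟨b, hb⟩ := hneg'.exists_smul_eq (neg_ne_zero.mpr hτ0) hσpos
    (fun h => by simp [h] at hκ')
  have hab : b * a = 1 := by
    have h := hσ.killingForm_apply_apply (x α) (x (-α))
    rw [hκ, ← ha, ← hb, LieModule.traceForm_comm] at h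
    simpa [hκ', mul_comm] using h
  rw [← ha, ← hb]
  simp only [TensorProduct.smul_tmul_smul, hab, mul_comm a b, one_smul, neg_sub]
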